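/- Let V be a real inner product space of finite dimension 2n+1 with n ≥ 1. Let ξ ∈ V be a unit vector, let η be the linear functional η(Y) = ⟨Y, ξ⟩, and let φ be a skew-adjoint endomorphism of V satisfying φ(φ(Y)) = -Y + η(Y)ξ for all Y ∈ V and φ(ξ) = 0. Let λ be a real number and let Q be a self-adjoint endomorphism of V satisfying Q(ξ) = 2n·ξ, Q∘φ = φ∘Q, and φ(Q(φ(Z))) + Q(φ(φ(Z))) = (λ + 2n)·φ(φ(Z)) for all Z ∈ V. Then Q(Z) = ((λ + 2n)/2)·Z + ((2n − λ)/2)·η(Z)·ξ for all Z ∈ V. (This is the pointwise derivation of the η-Einstein identity, equation (4.9), in the proof of Theorem 3.5.) -/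

import Mathlib

open RealInnerProductSpace

/-- The pointwise derivation of the η-Einstein identity (equation (4.9)) in the proof
of Theorem 3.5. -/
theorem eta_einstein_pointwise {V : Type*} [NormedAddCommGroup V] [InnerProductSpace ℝ V]
    [FiniteDimensional ℝ V] (n : ℕ) (hn : 1 ≤ n)
    (hdim : Module.finrank ℝ V = 2 * n + 1)
    (ξ : V) (hξ : ‖ξ‖ = 1)
    (φ Q : V →ₗ[ℝ] V) (lam : ℝ)
    (hφskew : ∀ Y Z : V, ⟪φ Y, Z⟫ = -⟪Y, φ Z⟫)
    (hφ2 : ∀ Y : V, φ (φ Y) = -Y + ⟪Y, ξ⟫ • ξ)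
    (hφξ : φ ξ = 0)
    (hQsym : ∀ Y Z : V, ⟪Q Y, Z⟫ = ⟪Y, Q Z⟫)
    (hQξ : Q ξ = ((2 * n : ℕ) : ℝ) • ξ)
    (hcomm : ∀ Y : V, Q (φ Y) = φ (Q Y))
    (hkey : ∀ Z : V, φ (Q (φ Z)) + Q (φ (φ Z)) = (lam + 2 * n) • φ (φ Z)) :
    ∀ Z : V, Q Z = ((lam + 2 * n) / 2) • Z + (((2 * n : ℝ) - lam) / 2) • (⟪Z, ξ⟫ • ξ) := by
  intro Z
  have h := hkey Z
  rw [← hcomm (φ Z), hφ2, map_add, map_neg, map_smul, hQξ] at h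
  push_cast at h
  linear_combination (norm := module) (-1 / 2 : ℝ) • h
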